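/- For every positive integer n with binary representation n = x_k…x_0 = Σ_{i=0}^k x_i 2^i, Margenstern's Turing machine M7 never halts when started from the initial configuration ω0 (A 1) x_0 1 x_1 1 x_2 … 1 x_k 0ω: the computation never reaches an undefined transition. -/

import Mathlib

namespace Collatz

/-- The 3x+1 function. -/
def T (x : ℕ) : ℕ := if x % 2 = 0 then x / 2 else (3 * x + 1) / 2

/-- The 3x+1 conjecture: iterating `T` from any positive integer
eventually reaches the loop `2 ↦ 1 ↦ 2`. -/
def CollatzConjecture : Prop :=
  ∀ x : ℕ, 0 < x → ∃ k : ℕ, T^[k] x = 2 ∧ T^[k + 1] x = 1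

inductive St | A | B | C | D | E | F | G | H | I | J | K
  deriving DecidableEq

/-- Symbols: `false` is the blank `0`, `true` is `1`. -/
abbrev Sym := Bool

open St

/-- Transition table of Margenstern's Turing machine `M7`
(`true` = move right, `false` = move left); `H` is an ordinary state,
`delta I true` is undefined. -/
def delta : St → Sym → Option (Sym × Bool × St)
  | A, false => some (true, true, I)
  | A, true  => some (false, true, B)
  | B, false => some (false, true, A)
  | B, true  => some (false, true, G)
  | C, false => some (false, true, A)
  | C, true  => some (true, true, D)
  | D, false => some (false, true, C)
  | D, true  => some (true, true, E)
  | E, false => some (true, true, I)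
  | E, true  => some (true, true, F)
  | F, false => some (true, true, C)
  | F, true  => some (false, true, G)
  | G, false => some (true, true, C)
  | G, true  => some (true, true, H)
  | H, false => some (false, true, E)
  | H, true  => some (true, true, G)
  | I, false => some (true, false, J)
  | I, true  => none
  | J, false => some (false, true, B)
  | J, true  => some (true, false, K)
  | K, false => some (false, false, J)
  | K, true  => some (true, false, J)

structure Cfg where
  state : St
  head : ℤ
  tape : ℤ → Sym

/-- One step of the machine; `none` when the transition is undefined
(in particular in the halting state, which has no transitions).
In `delta`, the `Bool` component is the direction: `true` = right, `false` = left. -/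
def step (c : Cfg) : Option Cfg :=
  (delta c.state (c.tape c.head)).map fun t =>
    ⟨t.2.2, c.head + (if t.2.1 then 1 else -1), Function.update c.tape c.head t.1⟩

/-- `steps n c` is the configuration after `n` steps from `c`
(`none` if the machine has halted meanwhile). -/
def steps : ℕ → Cfg → Option Cfg
  | 0, c => some c
  | n + 1, c => (step c).bind (steps n)

/-- The tape holding the word `w` at positions `0, …, w.length - 1`,
and the blank symbol everywhere else. -/
def tapeOf (w : List Sym) : ℤ → Sym :=
  fun i => if 0 ≤ i then w.getD i.toNat false else false

/-- `c` is the configuration `ωb u (q s) v bω`, where `w = u ++ s :: v` and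
`pos = u.length` (i.e. the tape holds exactly the word `w` surrounded by blanks,
the machine is in state `q`, and the head scans the symbol of `w` at index `pos`). -/
def IsConfig (c : Cfg) (q : St) (w : List Sym) (pos : ℕ) : Prop :=
  c.state = q ∧ ∃ d : ℤ, c.head = d + pos ∧ c.tape = fun i => tapeOf w (i - d)

/-- The machine eventually reaches the configuration `ωb u (q s) v bω`. -/
def Reaches (c : Cfg) (q : St) (w : List Sym) (pos : ℕ) : Prop :=
  ∃ t : ℕ, ∃ c' : Cfg, steps t c = some c' ∧ IsConfig c' q w pos

/-- The machine halts when started from configuration `c`. -/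
def Halts (c : Cfg) : Prop := ∃ n : ℕ, steps n c = none

/-- Initial configuration: word `w` on the tape, head on its leftmost symbol, state `A`. -/
def initCfg (w : List Sym) : Cfg := ⟨St.A, 0, tapeOf w⟩

/-- Encoding of a list of binary digits `[x_0, x_1, …, x_k]`
(least significant first) as the word `1 x_0 1 x_1 … 1 x_k`. -/
def codeList : List ℕ → List Sym
  | [] => []
  | d :: ds => true :: decide (d = 1) :: codeList ds

/-- The word `1 x_0 1 x_1 … 1 x_k` where `x_k … x_0` is the binary
representation of `n`. -/
def codeWord (n : ℕ) : List Sym := codeList (Nat.digits 2 n)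

/-- Markers occupy exactly the cells `2 i`, `a ≤ i < b`; all digits outside are blank. -/
def WF (f : ℤ → Sym) (a b : ℤ) : Prop :=
  (∀ i, f (2 * i) = decide (a ≤ i ∧ i < b)) ∧
  (∀ i, (i < a ∨ b ≤ i) → f (2 * i + 1) = false)

theorem WF.digit {f : ℤ → Sym} {a b p : ℤ} (h : WF f a b) (ha : a ≤ p) (hb : p < b) (v : Sym) :
    WF (Function.update f (2 * p + 1) v) a b := by
  refine ⟨fun i => ?_, fun i hi => ?_⟩
  · rw [Function.update_of_ne (by omega)]; exact h.1 i
  · rw [Function.update_of_ne (by omega)]; exact h.2 i hi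

theorem WF.extend {f : ℤ → Sym} {a b : ℤ} (h : WF f a b) (hab : a ≤ b) :
    WF (Function.update f (2 * b) true) a (b + 1) := by
  refine ⟨fun i => ?_, fun i hi => ?_⟩
  · by_cases hi : i = b
    · subst hi; simp [hab]
    · rw [Function.update_of_ne (by omega), h.1 i]
      exact decide_eq_decide.2 (by omega)
  · rw [Function.update_of_ne (by omega)]; exact h.2 i (by omega)

inductive Inv : Cfg → Prop
  | a1 (f : ℤ → Sym) (a b : ℤ) : WF f a b → a < b → f (2 * (b - 1) + 1) = true →
      Inv ⟨A, 2 * a, f⟩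
  | a2 (f : ℤ → Sym) (a b : ℤ) : WF f a b → a ≤ b → Inv ⟨A, 2 * b, f⟩
  | b (f : ℤ → Sym) (a b : ℤ) (v : Sym) :
      WF (Function.update f (2 * (a - 1) + 1) false) a b → a ≤ b →
      f (2 * (b - 1) + 1) = true → Inv ⟨B, 2 * (a - 1) + 1, f⟩
  | c1 (f : ℤ → Sym) (a b p : ℤ) : WF f a b → a ≤ p → p < b →
      f (2 * (b - 1) + 1) = true → Inv ⟨C, 2 * p, f⟩
  | c2 (f : ℤ → Sym) (a b : ℤ) : WF f a (b + 1) → a ≤ b → f (2 * b + 1) = false →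
      Inv ⟨C, 2 * b + 1, f⟩
  | marker (q : St) (f : ℤ → Sym) (a b p : ℤ) : q = E ∨ q = G → WF f a b → a ≤ p → p ≤ b →
      (p < b → f (2 * (b - 1) + 1) = true) → Inv ⟨q, 2 * p, f⟩
  | digit (q : St) (f : ℤ → Sym) (a b p : ℤ) : q = D ∨ q = F ∨ q = H → WF f a b →
      a ≤ p → p < b → f (2 * (b - 1) + 1) = true → Inv ⟨q, 2 * p + 1, f⟩
  | i (f : ℤ → Sym) (a b : ℤ) : WF f a (b + 1) → a ≤ b → f (2 * b + 1) = false →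
      Inv ⟨I, 2 * b + 1, f⟩
  | j (f : ℤ → Sym) (a b p : ℤ) : WF f a b → a < b → a - 1 ≤ p → p < b →
      f (2 * (b - 1) + 1) = true → Inv ⟨J, 2 * p, f⟩
  | k (f : ℤ → Sym) (a b p : ℤ) : WF f a b → a < b → a ≤ p → p < b →
      f (2 * (b - 1) + 1) = true → Inv ⟨K, 2 * (p - 1) + 1, f⟩

theorem step_some {q q' : St} {h h' : ℤ} {f : ℤ → Sym} {s v d : Bool}
    (hs : f h = s) (hd : delta q s = some (v, d, q')) (hh : h + (if d then 1 else -1) = h')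
    (hI : Inv ⟨q', h', Function.update f h v⟩) : ∃ c', step ⟨q, h, f⟩ = some c' ∧ Inv c' := by
  refine ⟨_, ?_, hI⟩
  simp [step, hs, hd, ← hh]

theorem step_same {q q' : St} {h h' : ℤ} {f : ℤ → Sym} {s d : Bool}
    (hs : f h = s) (hd : delta q s = some (s, d, q')) (hh : h + (if d then 1 else -1) = h')
    (hI : Inv ⟨q', h', f⟩) : ∃ c', step ⟨q, h, f⟩ = some c' ∧ Inv c' := by
  refine step_some hs hd hh ?_
  rw [← hs, Function.update_eq_self]; exact hI

theorem WF.mark {f : ℤ → Sym} {a b p : ℤ} (h : WF f a b) (ha : a ≤ p) (hb : p < b) :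
    f (2 * p) = true := by
  rw [h.1]; simp [ha, hb]

theorem WF.noMark {f : ℤ → Sym} {a b p : ℤ} (h : WF f a b) (hp : p < a ∨ b ≤ p) :
    f (2 * p) = false := by
  rw [h.1]; exact decide_eq_false (by omega)

theorem ne_last {f : ℤ → Sym} {b p : ℤ} (h : f (2 * (b - 1) + 1) = true)
    (hp : f (2 * p + 1) = false) : p ≠ b - 1 := by
  rintro rfl; simp [h] at hp

theorem inv_step (c : Cfg) (h : Inv c) : ∃ c', step c = some c' ∧ Inv c' := by
  cases h with
  | a1 f a b hw hab hl =>
    refine step_some (hw.mark le_rfl hab) rfl (h' := 2 * ((a + 1) - 1) + 1) (by simp) ?_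
    refine Inv.b _ (a + 1) b false ?_ (by omega) ?_
    · refine ⟨fun i => ?_, fun i hi => ?_⟩
      · rw [Function.update_of_ne (by omega)]
        by_cases hi : i = a
        · subst hi; simp
        · rw [Function.update_of_ne (by omega), hw.1]
          exact decide_eq_decide.2 (by omega)
      · by_cases hia : i = a
        · subst hia; simp
        · rw [Function.update_of_ne (by omega), Function.update_of_ne (by omega)]
          exact hw.2 i (by omega)
    · rw [Function.update_of_ne (by omega)]; exact hl
  | a2 f a b hw hab =>
    refine step_some (hw.noMark (Or.inr le_rfl)) rfl (h' := 2 * b + 1) (by simp) ?_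
    refine Inv.i _ a b (hw.extend hab) hab ?_
    rw [Function.update_of_ne (by omega)]; exact hw.2 b (by omega)
  | b f a b _ hw hab hl =>
    cases hx : f (2 * (a - 1) + 1) with
    | false =>
      have hne := ne_last hl hx
      refine step_same hx rfl (h' := 2 * a) (by simp; ring) ?_
      rw [← hx, Function.update_eq_self] at hw
      exact Inv.a1 f a b hw (by omega) hl
    | true =>
      refine step_some hx rfl (h' := 2 * a) (by simp; ring) ?_
      refine Inv.marker G _ a b a (by simp) hw le_rfl hab fun h => ?_
      rw [Function.update_of_ne (by omega)]; exact hl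
  | c1 f a b p hw ha hb hl =>
    exact step_same (hw.mark ha hb) rfl (h' := 2 * p + 1) (by simp)
      (Inv.digit D f a b p (by simp) hw ha hb hl)
  | c2 f a b hw hab hx =>
    exact step_same hx rfl (h' := 2 * (b + 1)) (by simp; ring)
      (Inv.a2 f a (b + 1) hw (by omega))
  | marker q f a b p hq hw ha hb hl =>
    rcases hb.lt_or_eq with hb' | rfl
    · rcases hq with rfl | rfl
      · exact step_same (hw.mark ha hb') rfl (h' := 2 * p + 1) (by simp)
          (Inv.digit F f a b p (by simp) hw ha hb' (hl hb'))
      · exact step_same (hw.mark ha hb') rfl (h' := 2 * p + 1) (by simp)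
          (Inv.digit H f a b p (by simp) hw ha hb' (hl hb'))
    · have hx : Function.update f (2 * p) true (2 * p + 1) = false := by
        rw [Function.update_of_ne (by omega)]; exact hw.2 p (by omega)
      rcases hq with rfl | rfl
      · exact step_some (hw.noMark (Or.inr le_rfl)) rfl (h' := 2 * p + 1) (by simp)
          (Inv.i _ a p (hw.extend ha) ha hx)
      · exact step_some (hw.noMark (Or.inr le_rfl)) rfl (h' := 2 * p + 1) (by simp)
          (Inv.c2 _ a p (hw.extend ha) ha hx)
  | digit q f a b p hq hw ha hb hl =>
    cases hx : f (2 * p + 1) with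
    | false =>
      have hne := ne_last hl hx
      rcases hq with rfl | rfl | rfl
      · exact step_same hx rfl (h' := 2 * (p + 1)) (by simp; ring)
          (Inv.c1 f a b (p + 1) hw (by omega) (by omega) hl)
      · refine step_some hx rfl (h' := 2 * (p + 1)) (by simp; ring)
          (Inv.c1 _ a b (p + 1) (hw.digit ha hb _) (by omega) (by omega) ?_)
        rw [Function.update_of_ne (by omega)]; exact hl
      · exact step_same hx rfl (h' := 2 * (p + 1)) (by simp; ring)
          (Inv.marker E f a b (p + 1) (by simp) hw (by omega) (by omega) fun _ => hl)
    | true =>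
      rcases hq with rfl | rfl | rfl
      · exact step_same hx rfl (h' := 2 * (p + 1)) (by simp; ring)
          (Inv.marker E f a b (p + 1) (by simp) hw (by omega) (by omega) fun _ => hl)
      · refine step_some hx rfl (h' := 2 * (p + 1)) (by simp; ring)
          (Inv.marker G _ a b (p + 1) (by simp) (hw.digit ha hb _) (by omega) (by omega)
            fun h => ?_)
        rw [Function.update_of_ne (by omega)]; exact hl
      · exact step_same hx rfl (h' := 2 * (p + 1)) (by simp; ring)
          (Inv.marker G f a b (p + 1) (by simp) hw (by omega) (by omega) fun _ => hl)
  | i f a b hw hab hx =>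
    refine step_some hx rfl (h' := 2 * b) (by simp)
      (Inv.j _ a (b + 1) b (hw.digit hab (by omega) _) (by omega) (by omega) (by omega) ?_)
    simp
  | j f a b p hw hab ha hb hl =>
    by_cases hp : a ≤ p
    · exact step_same (hw.mark hp hb) rfl (h' := 2 * (p - 1) + 1) (by simp; ring)
        (Inv.k f a b p hw hab hp hb hl)
    · obtain rfl : p = a - 1 := by omega
      refine step_same (hw.noMark (by omega)) rfl (h' := 2 * (a - 1) + 1) (by simp)
        (Inv.b f a b false ?_ hab.le hl)
      rw [← hw.2 (a - 1) (by omega), Function.update_eq_self]; exact hw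
  | k f a b p hw hab ha hb hl =>
    have hJ := Inv.j f a b (p - 1) hw hab (by omega) (by omega) hl
    cases hx : f (2 * (p - 1) + 1) with
    | false => exact step_same hx rfl (by simp) hJ
    | true => exact step_same hx rfl (by simp) hJ

theorem inv_steps (t : ℕ) : ∀ c, Inv c → steps t c ≠ none := by
  induction t with
  | zero => intro c _; simp [steps]
  | succ t ih =>
    intro c hc
    obtain ⟨c', hs, hc'⟩ := inv_step c hc
    simpa [steps, hs] using ih c' hc'

theorem code_even (l : List ℕ) : ∀ k, (codeList l).getD (2 * k) false = decide (k < l.length) := by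
  induction l with
  | nil => simp [codeList]
  | cons d l ih =>
    rintro (_ | k)
    · simp [codeList]
    · have := ih k
      simp only [codeList, show 2 * (k + 1) = 2 * k + 1 + 1 by ring, List.getD_cons_succ, this]
      simp

theorem code_odd (l : List ℕ) :
    ∀ k, (codeList l).getD (2 * k + 1) false = decide (l.getD k 0 = 1) := by
  induction l with
  | nil => simp [codeList]
  | cons d l ih =>
    rintro (_ | k)
    · simp [codeList]
    · have := ih k
      simp only [codeList, show 2 * (k + 1) + 1 = 2 * k + 1 + 1 + 1 by ring,
        List.getD_cons_succ, this]

theorem tape_odd (l : List ℕ) (k : ℕ) :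
    tapeOf (codeList l) (2 * (k : ℤ) + 1) = decide (l.getD k 0 = 1) := by
  rw [tapeOf, if_pos (by omega), show (2 * (k : ℤ) + 1).toNat = 2 * k + 1 by omega, code_odd]

theorem wf_init (l : List ℕ) : WF (tapeOf (codeList l)) 0 l.length := by
  refine ⟨fun i => ?_, fun i hi => ?_⟩
  · by_cases h : 0 ≤ i
    · lift i to ℕ using h
      rw [tapeOf, if_pos (by omega), show (2 * (i : ℤ)).toNat = 2 * i by omega, code_even]
      exact decide_eq_decide.2 (by omega)
    · rw [tapeOf, if_neg (by omega)]
      exact (decide_eq_false (by omega)).symm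
  · by_cases h : 0 ≤ i
    · lift i to ℕ using h
      rw [tape_odd, List.getD_eq_default _ _ (by omega)]; rfl
    · rw [tapeOf, if_neg (by omega)]

/-- For every positive integer `n` with binary representation `n = x_k … x_0`,
Margenstern's machine `M7` never halts when started from
`ω0 (A 1) x_0 1 x_1 … 1 x_k 0ω`: it never reaches an undefined transition. -/
theorem M7_never_halts (n : ℕ) (hn : 0 < n) :
    ∀ t : ℕ, steps t (initCfg (codeWord n)) ≠ none := by
  have hne : Nat.digits 2 n ≠ [] := Nat.digits_ne_nil_iff_ne_zero.2 hn.ne'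
  have hpos : 0 < (Nat.digits 2 n).length := List.length_pos_iff.2 hne
  have hlast : (Nat.digits 2 n).getD ((Nat.digits 2 n).length - 1) 0 = 1 := by
    have h1 := Nat.getLast_digit_ne_zero 2 hn.ne'
    have h2 := Nat.digits_lt_base (le_refl 2) (List.getLast_mem hne)
    rw [List.getD_eq_getElem _ _ (by omega), ← List.getLast_eq_getElem hne]
    omega
  intro t
  refine inv_steps t _ ?_
  refine Inv.a1 _ 0 (Nat.digits 2 n).length (wf_init _) (by exact_mod_cast hpos) ?_
  have := tape_odd (Nat.digits 2 n) ((Nat.digits 2 n).length - 1)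
  rw [hlast, Nat.cast_sub (by omega)] at this
  simpa [codeWord] using this

end Collatz
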